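/- Fix j ∈ {1,…,m}, let ℓ_j := d_j − 1, θ_j(x,z) := z² − ‖∇g_j(x)‖², and τ > sup_{x∈Ω_j} ‖∇g_j(x)‖². Let (v_{j,α})_{α∈ℕⁿ} be the moments of φ_j. For d ≥ d²_min := max{1, r₁,…,r_m, ℓ_j}, consider the semidefinite programs over sequences u = (u_{α,k})_{(α,k)∈ℕ^{n+1}, |(α,k)|≤2d}: ρ̄_{j,d} = sup u_{0,1} and ρ̲_{j,d} = inf u_{0,1}, both subject to u_{α,0} = v_{j,α} for all |α| ≤ 2d, M_d(u) ⪰ 0, M_{d−ℓ_j}(θ_j·u) = 0, M_{d−1}((τ−z²)·u) ⪰ 0 and M_{d−1}(z·u) ⪰ 0. If the feasible set is nonempty for each d ≥ d²_min, then both programs have optimal solutions u^d (for sup) and w^d (for inf), and lim_{d→∞} u^d_{α,1} = lim_{d→∞} w^d_{α,1} = ∫_{Ω_j} x^α dσ_j for every α ∈ ℕⁿ. In particular ρ̄_{j,d} ↓ σ_j(Ω_j) and ρ̲_{j,d} ↑ σ_j(Ω_j) as d → ∞. -/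

import Mathlib

open MeasureTheory MvPolynomial Filter Topology
open scoped ENNReal

noncomputable section

/-- the monomial `x^α` -/
def monom {n : ℕ} (α : Fin n → ℕ) (x : EuclideanSpace ℝ (Fin n)) : ℝ := ∏ i, x i ^ α i

/-- `|α| = α₁ + ⋯ + αₙ` -/
def degSum {n : ℕ} (α : Fin n → ℕ) : ℕ := ∑ i, α i

/-- evaluation of a polynomial at a point of Euclidean space -/
def pev {n : ℕ} (p : MvPolynomial (Fin n) ℝ) (x : EuclideanSpace ℝ (Fin n)) : ℝ :=
  eval (fun i => x i) p

/-- the Riesz functional `L_y` of a multisequence `y` -/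
def riesz {n : ℕ} (y : (Fin n → ℕ) → ℝ) (p : MvPolynomial (Fin n) ℝ) : ℝ :=
  ∑ m ∈ p.support, p.coeff m * y (fun i => m i)

/-- positive semidefiniteness of the localizing matrix `M(g·y)` with rows and columns
indexed by monomials of degree `≤ k` (equivalent quadratic-form formulation:
`0 ≤ L_y(g·p²)` for every polynomial `p` of degree `≤ k`). -/
def locPSD {n : ℕ} (y : (Fin n → ℕ) → ℝ) (g : MvPolynomial (Fin n) ℝ) (k : ℕ) : Prop :=
  ∀ p : MvPolynomial (Fin n) ℝ, p.totalDegree ≤ k → 0 ≤ riesz y (g * p ^ 2)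

/-- the localizing matrix `M(g·y)` with rows/columns of degree `≤ k` vanishes
(entrywise, extended bilinearly). -/
def locZero {n : ℕ} (y : (Fin n → ℕ) → ℝ) (g : MvPolynomial (Fin n) ℝ) (k : ℕ) : Prop :=
  ∀ p q : MvPolynomial (Fin n) ℝ, p.totalDegree ≤ k → q.totalDegree ≤ k →
    riesz y (g * (p * q)) = 0

/-- a Borel measure `μ` represents the multisequence `y` if all monomials are
`μ`-integrable with `∫ x^α dμ = y_α`. -/
def Represents {n : ℕ} (μ : Measure (EuclideanSpace ℝ (Fin n))) (y : (Fin n → ℕ) → ℝ) : Prop :=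
  ∀ α : Fin n → ℕ, Integrable (monom α) μ ∧ ∫ x, monom α x ∂μ = y α

/-- `‖∇g(x)‖²` -/
def gradSq {n : ℕ} (p : MvPolynomial (Fin n) ℝ) (x : EuclideanSpace ℝ (Fin n)) : ℝ :=
  ∑ i, (pev (pderiv i p) x) ^ 2

/-- `‖∇g(x)‖` -/
def gradNorm {n : ℕ} (p : MvPolynomial (Fin n) ℝ) (x : EuclideanSpace ℝ (Fin n)) : ℝ :=
  Real.sqrt (gradSq p x)

/-- `q(x) = ⟨x, ∇g(x)⟩` -/
def xGrad {n : ℕ} (p : MvPolynomial (Fin n) ℝ) (x : EuclideanSpace ℝ (Fin n)) : ℝ :=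
  ∑ i, x i * pev (pderiv i p) x

/-- the basic closed semi-algebraic set `Ω = {x | g_j(x) ≤ b_j, j = 1,…,m}` -/
def Om {n m : ℕ} (g : Fin m → MvPolynomial (Fin n) ℝ) (b : Fin m → ℝ) :
    Set (EuclideanSpace ℝ (Fin n)) :=
  {x | ∀ j, pev (g j) x ≤ b j}

/-- `Ω_j = {x ∈ Ω | g_j(x) = b_j}` -/
def OmJ {n m : ℕ} (g : Fin m → MvPolynomial (Fin n) ℝ) (b : Fin m → ℝ) (j : Fin m) :
    Set (EuclideanSpace ℝ (Fin n)) :=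
  {x | x ∈ Om g b ∧ pev (g j) x = b j}

/-- the open box `B = (−1,1)ⁿ` -/
def Box (n : ℕ) : Set (EuclideanSpace ℝ (Fin n)) := {x | ∀ i, |x i| < 1}

/-- the `(n−1)`-dimensional Hausdorff measure on `ℝⁿ` -/
def hsd (n : ℕ) : Measure (EuclideanSpace ℝ (Fin n)) := μH[(n : ℝ) - 1]

/-- `σ_j`: the restriction to `Ω_j` of the `(n−1)`-dimensional Hausdorff measure -/
def sigmaJ {n m : ℕ} (g : Fin m → MvPolynomial (Fin n) ℝ) (b : Fin m → ℝ) (j : Fin m) :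
    Measure (EuclideanSpace ℝ (Fin n)) :=
  (hsd n).restrict (OmJ g b j)

/-- `φ_j`: the measure `dφ_j = ‖∇g_j‖⁻¹ dσ_j` on `Ω_j` -/
def phiJ {n m : ℕ} (g : Fin m → MvPolynomial (Fin n) ℝ) (b : Fin m → ℝ) (j : Fin m) :
    Measure (EuclideanSpace ℝ (Fin n)) :=
  (sigmaJ g b j).withDensity fun x => ENNReal.ofReal (gradNorm (g j) x)⁻¹


/-- lift a polynomial in `x` to a polynomial in `(x, z)` -/
def liftP {n : ℕ} (p : MvPolynomial (Fin n) ℝ) : MvPolynomial (Fin (n + 1)) ℝ :=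
  rename Fin.castSucc p

/-- the variable `z` -/
def zP (n : ℕ) : MvPolynomial (Fin (n + 1)) ℝ := X (Fin.last n)

/-- `θ(x,z) = z² − ‖∇g(x)‖²` as a polynomial in `(x, z)` -/
def thetaP {n : ℕ} (p : MvPolynomial (Fin n) ℝ) : MvPolynomial (Fin (n + 1)) ℝ :=
  zP n ^ 2 - ∑ i : Fin n, liftP (pderiv i p) ^ 2

/-- the multi-index `(α, k) ∈ ℕ^{n+1}` -/
def idxZ {n : ℕ} (α : Fin n → ℕ) (k : ℕ) : Fin (n + 1) → ℕ := Fin.snoc α k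

/-- the moments `v_{j,α} = ∫_{Ω_j} x^α dφ_j` of `φ_j` -/
def phiMom {n m : ℕ} (g : Fin m → MvPolynomial (Fin n) ℝ) (b : Fin m → ℝ) (j : Fin m)
    (α : Fin n → ℕ) : ℝ := ∫ x, monom α x ∂(phiJ g b j)

/-- feasibility for the order-`d` second-step semidefinite program
\eqref{second-step}/\eqref{second-step-inf}, with data `v` (the moments of `φ_j`),
over finite sequences `u = (u_{α,k})_{|(α,k)|≤2d}`: `u_{α,0} = v_α` for `|α| ≤ 2d`,
`M_d(u) ⪰ 0`, `M_{d−ℓ}(θ·u) = 0`, `M_{d−1}((τ−z²)·u) ⪰ 0` and `M_{d−1}(z·u) ⪰ 0`. -/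
def FeasSDP2 {n : ℕ} (θ : MvPolynomial (Fin (n + 1)) ℝ) (τ : ℝ) (ℓ : ℕ)
    (v : (Fin n → ℕ) → ℝ) (d : ℕ) (u : (Fin (n + 1) → ℕ) → ℝ) : Prop :=
  (∀ γ : Fin (n + 1) → ℕ, 2 * d < degSum γ → u γ = 0) ∧
  (∀ α : Fin n → ℕ, degSum α ≤ 2 * d → u (idxZ α 0) = v α) ∧
  (∀ p : MvPolynomial (Fin (n + 1)) ℝ, p.totalDegree ≤ d → 0 ≤ riesz u (p ^ 2)) ∧
  locZero u θ (d - ℓ) ∧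
  locPSD u (C τ - zP n ^ 2) (d - 1) ∧
  locPSD u (zP n) (d - 1)

/-- optimality for the `sup`-version \eqref{second-step} of the second-step SDP -/
def IsMaxSDP2 {n : ℕ} (θ : MvPolynomial (Fin (n + 1)) ℝ) (τ : ℝ) (ℓ : ℕ)
    (v : (Fin n → ℕ) → ℝ) (d : ℕ) (u : (Fin (n + 1) → ℕ) → ℝ) : Prop :=
  FeasSDP2 θ τ ℓ v d u ∧
  ∀ u', FeasSDP2 θ τ ℓ v d u' → u' (idxZ (fun _ => 0) 1) ≤ u (idxZ (fun _ => 0) 1)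

/-- optimality for the `inf`-version \eqref{second-step-inf} of the second-step SDP -/
def IsMinSDP2 {n : ℕ} (θ : MvPolynomial (Fin (n + 1)) ℝ) (τ : ℝ) (ℓ : ℕ)
    (v : (Fin n → ℕ) → ℝ) (d : ℕ) (u : (Fin (n + 1) → ℕ) → ℝ) : Prop :=
  FeasSDP2 θ τ ℓ v d u ∧
  ∀ u', FeasSDP2 θ τ ℓ v d u' → u (idxZ (fun _ => 0) 1) ≤ u' (idxZ (fun _ => 0) 1)


lemma pev_continuous {n : ℕ} (p : MvPolynomial (Fin n) ℝ) : Continuous (pev p) := by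
  unfold pev
  exact (MvPolynomial.continuous_eval p).comp (by fun_prop)

lemma gradSq_continuous {n : ℕ} (p : MvPolynomial (Fin n) ℝ) : Continuous (gradSq p) := by
  unfold gradSq
  exact continuous_finsetSum _ fun i _ => (pev_continuous _).pow 2

lemma gradSq_nonneg {n : ℕ} (p : MvPolynomial (Fin n) ℝ) (x) : 0 ≤ gradSq p x := by
  unfold gradSq
  positivity

lemma pev_hasStrictFDerivAt {n : ℕ} (p : MvPolynomial (Fin n) ℝ)
    (x : EuclideanSpace ℝ (Fin n)) :
    HasStrictFDerivAt (pev p)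
      (∑ i, pev (pderiv i p) x • (EuclideanSpace.proj i : EuclideanSpace ℝ (Fin n) →L[ℝ] ℝ)) x := by
  induction p using MvPolynomial.induction_on with
  | C a =>
    have : pev (C a : MvPolynomial (Fin n) ℝ) = fun _ => a := by funext y; simp [pev]
    rw [this]
    refine (hasStrictFDerivAt_const a x).congr_fderiv ?_
    simp [pev]
  | add p q hp hq =>
    have : pev (p + q) = fun y => pev p y + pev q y := by funext y; simp [pev]
    rw [this]
    refine (hp.add hq).congr_fderiv ?_
    simp [pev, add_smul, Finset.sum_add_distrib]
  | mul_X p i hp =>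
    have : pev (p * X i) = fun y => pev p y * (EuclideanSpace.proj i : EuclideanSpace ℝ (Fin n) →L[ℝ] ℝ) y := by
      funext y; simp [pev]
    rw [this]
    refine (hp.mul (EuclideanSpace.proj i : EuclideanSpace ℝ (Fin n) →L[ℝ] ℝ).hasStrictFDerivAt).congr_fderiv ?_
    symm
    ext y
    simp only [sum_apply, smul_apply, add_apply,
      smul_eq_mul, Derivation.leibniz, pderiv_X, pev, PiLp.proj_apply, map_add, map_mul, eval_X]
    simp only [add_mul, Finset.sum_add_distrib, Finset.mul_sum]
    congr 1
    · rw [Finset.sum_eq_single i]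
      · simp
      · intro k _ hk; simp [Pi.single_apply, hk, hk.symm]
      · simp
    · exact Finset.sum_congr rfl fun k _ => by ring

lemma hsd_fin {n : ℕ} (p : MvPolynomial (Fin n) ℝ) (c : ℝ) (K : Set (EuclideanSpace ℝ (Fin n)))
    (hK : IsCompact K) (hc : ∀ x ∈ K, pev p x = c) (hg : ∀ x ∈ K, gradNorm p x ≠ 0) :
    hsd n K < ∞ := by
  refine hK.measure_lt_top_of_nhdsWithin fun x hx => ?_
  have hx0 : gradSq p x ≠ 0 := by
    intro h; apply hg x hx; simp [gradNorm, h]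
  obtain ⟨i, hi⟩ : ∃ i, pev (pderiv i p) x ≠ 0 := by
    by_contra! h
    apply hx0; simp [gradSq, h]
  obtain ⟨k, rfl⟩ : ∃ k, n = k + 1 := ⟨n - 1, by have := i.pos; omega⟩
  set D : EuclideanSpace ℝ (Fin (k+1)) →L[ℝ] ℝ :=
    ∑ i, pev (pderiv i p) x • (EuclideanSpace.proj i : EuclideanSpace ℝ (Fin (k+1)) →L[ℝ] ℝ) with hD
  let π : EuclideanSpace ℝ (Fin (k+1)) →L[ℝ] (Fin k → ℝ) :=
    ContinuousLinearMap.pi fun l => EuclideanSpace.proj (i.succAbove l)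
  have hinj : LinearMap.ker ((π.prod D : EuclideanSpace ℝ (Fin (k+1)) →L[ℝ] (Fin k → ℝ) × ℝ) : 
     EuclideanSpace ℝ (Fin (k+1)) →ₗ[ℝ] (Fin k → ℝ) × ℝ) = ⊥ := by
    rw [LinearMap.ker_eq_bot']
    intro w hw
    have h1 : π w = 0 := congrArg Prod.fst hw
    have h2 : D w = 0 := congrArg Prod.snd hw
    have h3 : ∀ l, w (i.succAbove l) = 0 := fun l => congrFun h1 l
    have h4 : D w = pev (pderiv i p) x * w i := by
      rw [hD]
      simp only [sum_apply, smul_apply, smul_eq_mul,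
        PiLp.proj_apply]
      rw [Fin.sum_univ_succAbove _ i]
      simp [h3]
    have h5 : w i = 0 := by
      rw [h4] at h2
      exact (mul_eq_zero.1 h2).resolve_left hi
    ext l
    rcases Fin.eq_self_or_eq_succAbove i l with h | ⟨l', h⟩
    · rw [h]; simpa using h5
    · rw [h]; simpa using h3 l'
  obtain ⟨C, hC0, hC⟩ := LinearMap.exists_antilipschitzWith _ hinj
  have hCb : ∀ w, ‖w‖ ≤ C * max ‖π w‖ |D w| := by
    intro w
    have := hC.le_mul_dist w 0
    rw [dist_zero_right, map_zero, dist_zero_right] at this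
    exact this
  have hC0' : (0:ℝ) < C := hC0
  have hst := pev_hasStrictFDerivAt p x
  rw [← hD] at hst
  obtain ⟨s, hs, hsa⟩ := hst.approximates_deriv_on_nhds (c := (2 * C)⁻¹) (Or.inr (by positivity))
  let T := (s ∩ Metric.ball x 1) ∩ K
  refine ⟨T, by
    change (s ∩ Metric.ball x 1) ∩ K ∈ 𝓝[K] x
    rw [Set.inter_comm]
    exact inter_mem_nhdsWithin _ (Filter.inter_mem hs (Metric.ball_mem_nhds x one_pos)), ?_⟩
  have hL : ∀ y ∈ T, ∀ z ∈ T, ‖y - z‖ ≤ C * ‖π y - π z‖ := by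
    intro y hy z hz
    have h1 := hsa y hy.1.1 z hz.1.1
    rw [hc y hy.2, hc z hz.2, sub_self, zero_sub, norm_neg, Real.norm_eq_abs] at h1
    have h2 := hCb (y - z)
    rw [← map_sub]
    rcases le_total |D (y - z)| ‖π (y - z)‖ with h | h
    · rwa [max_eq_left h] at h2
    · rw [max_eq_right h] at h2
      have h3 : C * |D (y - z)| ≤ ‖y - z‖ / 2 := by
        calc C * |D (y - z)| ≤ C * (((2 * C)⁻¹ : NNReal) * ‖y - z‖) := by gcongr
          _ = _ := by push_cast; field_simp
      have h4 : 0 ≤ C * ‖π (y - z)‖ := by positivity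
      linarith
  have hinjT : Set.InjOn π T := by
    intro y hy z hz h
    have := hL y hy z hz
    rw [h, sub_self, norm_zero, mul_zero] at this
    exact sub_eq_zero.1 (norm_le_zero_iff.1 this)
  have hlip : LipschitzOnWith C (Function.invFunOn π T) (π '' T) := by
    apply LipschitzOnWith.of_dist_le_mul
    rintro _ ⟨y, hy, rfl⟩ _ ⟨z, hz, rfl⟩
    rw [hinjT.leftInvOn_invFunOn hy, hinjT.leftInvOn_invFunOn hz, dist_eq_norm, dist_eq_norm]
    exact hL y hy z hz
  have him : Function.invFunOn π T '' (π '' T) = T := by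
    exact Set.LeftInvOn.image_image hinjT.leftInvOn_invFunOn
  have h1 := hlip.hausdorffMeasure_image_le (d := k) (by positivity)
  rw [him] at h1
  have hk : hsd (k+1) T = μH[(k:ℝ)] T := by simp [hsd]
  rw [hk]
  refine h1.trans_lt ?_
  have h2 : (μH[(k:ℝ)] : Measure (Fin k → ℝ)) = volume := by
    simpa using hausdorffMeasure_pi_real (ι := Fin k)
  rw [h2]
  refine ENNReal.mul_lt_top (ENNReal.rpow_lt_top_of_nonneg (by positivity) (by simp)) ?_
  have hb : Bornology.IsBounded T := Metric.isBounded_ball.subset fun y hy => hy.1.2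
  exact (π.lipschitz.isBounded_image hb).measure_lt_top

section meas
variable {n m : ℕ} {g : Fin m → MvPolynomial (Fin n) ℝ} {b : Fin m → ℝ} {j : Fin m}

lemma OmJ_compact (hcomp : IsCompact (Om g b)) : IsCompact (OmJ g b j) := by
  have : OmJ g b j = Om g b ∩ {x | pev (g j) x = b j} := rfl
  rw [this]
  exact hcomp.inter_right (isClosed_eq (pev_continuous _) continuous_const)

lemma gradNorm_continuous {n : ℕ} (p : MvPolynomial (Fin n) ℝ) : Continuous (gradNorm p) :=
  Real.continuous_sqrt.comp (gradSq_continuous p)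

lemma gradNorm_pos (hgrad : ∀ k, ∀ x ∈ OmJ g b k, gradNorm (g k) x ≠ 0) {x} (hx : x ∈ OmJ g b j) :
    0 < gradNorm (g j) x := lt_of_le_of_ne (Real.sqrt_nonneg _) (hgrad j x hx).symm

lemma exists_delta (hcomp : IsCompact (Om g b))
    (hgrad : ∀ k, ∀ x ∈ OmJ g b k, gradNorm (g k) x ≠ 0) :
    ∃ δ > 0, ∀ x ∈ OmJ g b j, δ ≤ gradNorm (g j) x := by
  have hK : IsCompact (OmJ g b j) := OmJ_compact hcomp
  rcases (OmJ g b j).eq_empty_or_nonempty with h | h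
  · exact ⟨1, one_pos, by simp [h]⟩
  · obtain ⟨x, hx, hmin⟩ := hK.exists_isMinOn h (gradNorm_continuous (g j)).continuousOn
    exact ⟨gradNorm (g j) x, gradNorm_pos hgrad hx, fun y hy => hmin hy⟩

lemma sigma_fin (hcomp : IsCompact (Om g b))
    (hgrad : ∀ k, ∀ x ∈ OmJ g b k, gradNorm (g k) x ≠ 0) : IsFiniteMeasure (sigmaJ g b j) :=
  ⟨by
    unfold sigmaJ
    rw [Measure.restrict_apply_univ]
    exact hsd_fin (g j) (b j) _ (OmJ_compact hcomp) (fun x hx => hx.2) (hgrad j)⟩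

lemma sigma_ae (hcomp : IsCompact (Om g b)) : ∀ᵐ x ∂(sigmaJ g b j), x ∈ OmJ g b j :=
  ae_restrict_mem (OmJ_compact hcomp).measurableSet

lemma dens_meas : Measurable fun x => (gradNorm (g j) x)⁻¹ :=
  (gradNorm_continuous (g j)).measurable.inv

lemma phi_ae (hcomp : IsCompact (Om g b)) : ∀ᵐ x ∂(phiJ g b j), x ∈ OmJ g b j :=
  (withDensity_absolutelyContinuous _ _).ae_le (sigma_ae hcomp)

lemma phi_fin (hcomp : IsCompact (Om g b))
    (hgrad : ∀ k, ∀ x ∈ OmJ g b k, gradNorm (g k) x ≠ 0) : IsFiniteMeasure (phiJ g b j) := by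
  haveI := sigma_fin (j := j) hcomp hgrad
  obtain ⟨δ, hδ, hb⟩ := exists_delta (j := j) hcomp hgrad
  refine isFiniteMeasure_withDensity_ofReal ?_
  refine Integrable.hasFiniteIntegral ?_
  refine Integrable.of_bound dens_meas.aestronglyMeasurable (δ⁻¹) ?_
  filter_upwards [sigma_ae hcomp] with x hx
  have h1 := hb x hx
  rw [Real.norm_of_nonneg (inv_nonneg.2 (hδ.le.trans h1))]
  gcongr

lemma phi_integral (hcomp : IsCompact (Om g b))
    (hgrad : ∀ k, ∀ x ∈ OmJ g b k, gradNorm (g k) x ≠ 0) (f : EuclideanSpace ℝ (Fin n) → ℝ) :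
    ∫ x, f x * gradNorm (g j) x ∂(phiJ g b j) = ∫ x in OmJ g b j, f x ∂(hsd n) := by
  unfold phiJ
  have h : (fun x => ENNReal.ofReal (gradNorm (g j) x)⁻¹) =
      fun x => ((Real.toNNReal (gradNorm (g j) x)⁻¹ : NNReal) : ℝ≥0∞) := rfl
  rw [h, integral_withDensity_eq_integral_smul (dens_meas.real_toNNReal)]
  refine integral_congr_ae ?_
  filter_upwards [sigma_ae hcomp] with x hx
  have h1 := gradNorm_pos hgrad hx
  rw [NNReal.smul_def, Real.coe_toNNReal _ (inv_nonneg.2 h1.le), smul_eq_mul]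
  field_simp

end meas

lemma integrable_cont {n : ℕ} {φ : Measure (EuclideanSpace ℝ (Fin n))} [IsFiniteMeasure φ]
    {K : Set (EuclideanSpace ℝ (Fin n))} (hK : IsCompact K) (hφ : ∀ᵐ x ∂φ, x ∈ K)
    {f : EuclideanSpace ℝ (Fin n) → ℝ} (hf : Continuous f) : Integrable f φ := by
  obtain ⟨M, hM⟩ := hK.exists_bound_of_continuousOn hf.continuousOn
  refine Integrable.of_bound hf.aestronglyMeasurable M ?_
  filter_upwards [hφ] with x hx using hM x hx

lemma stone {n : ℕ} {K : Set (EuclideanSpace ℝ (Fin n))} (hK : IsCompact K)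
    {h : EuclideanSpace ℝ (Fin n) → ℝ} (hh : Continuous h) {ε : ℝ} (hε : 0 < ε) :
    ∃ s : MvPolynomial (Fin n) ℝ, ∀ x ∈ K, |pev s x - h x| < ε := by
  haveI : CompactSpace K := isCompact_iff_compactSpace.1 hK
  let cX : Fin n → C(K, ℝ) := fun i => ⟨fun x => x.1 i, by fun_prop⟩
  let A : Subalgebra ℝ C(K, ℝ) := (aeval cX : MvPolynomial (Fin n) ℝ →ₐ[ℝ] C(K, ℝ)).range
  have hev : ∀ (p : MvPolynomial (Fin n) ℝ) (x : K), (aeval cX p) x = pev p x := by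
    intro p x
    induction p using MvPolynomial.induction_on with
    | C a => simp [pev]
    | add p q hp hq => simp [pev] at hp hq ⊢; rw [hp, hq]
    | mul_X p i hp => simp [pev] at hp ⊢; rw [hp]; rfl
  have hsep : A.SeparatesPoints := by
    intro x y hxy
    have : ∃ i, x.1 i ≠ y.1 i := by
      by_contra! hc
      apply hxy
      apply Subtype.ext
      ext i
      exact hc i
    obtain ⟨i, hi⟩ := this
    refine ⟨cX i, ⟨cX i, ⟨X i, by simp⟩, rfl⟩, hi⟩
  obtain ⟨⟨f, ⟨s, rfl⟩⟩, hf⟩ := ContinuousMap.exists_mem_subalgebra_near_continuousMap_of_separatesPoints A hsep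
    ⟨fun x => h x.1, by fun_prop⟩ ε hε
  refine ⟨s, fun x hx => ?_⟩
  have h1 := (ContinuousMap.norm_coe_le_norm _ (⟨x, hx⟩ : K)).trans_lt hf
  have h2 := hev s ⟨x, hx⟩
  simpa [h2] using h1

def RL {n : ℕ} (y : (Fin n → ℕ) → ℝ) : MvPolynomial (Fin n) ℝ →ₗ[ℝ] ℝ :=
  (basisMonomials (Fin n) ℝ).constr ℝ (fun m => y (fun i => m i))

lemma RL_mon {n : ℕ} (y : (Fin n → ℕ) → ℝ) (m : Fin n →₀ ℕ) (c : ℝ) :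
    RL y (monomial m c) = c * y m := by
  have h : monomial m c = c • basisMonomials (Fin n) ℝ m := by
    simp [smul_monomial]
  rw [h, map_smul, RL, Module.Basis.constr_basis]; rfl

lemma riesz_eq {n : ℕ} (y : (Fin n → ℕ) → ℝ) (p : MvPolynomial (Fin n) ℝ) :
    riesz y p = RL y p := by
  conv_rhs => rw [p.as_sum]
  rw [map_sum]
  exact Finset.sum_congr rfl fun m _ => (RL_mon y m _).symm

lemma degSum_coe {n : ℕ} (m : Fin n →₀ ℕ) : degSum (m : Fin n → ℕ) = m.degree := by
  rw [Finsupp.degree_eq_sum]; rfl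

lemma degree_le_of_mem {n : ℕ} {p : MvPolynomial (Fin n) ℝ} {m : Fin n →₀ ℕ} (h : m ∈ p.support) :
    m.degree ≤ p.totalDegree := le_totalDegree h

lemma totalDegree_mono {n : ℕ} (m : Fin n →₀ ℕ) (c : ℝ) :
    (monomial m c : MvPolynomial (Fin n) ℝ).totalDegree ≤ m.degree := totalDegree_monomial_le m c

lemma riesz_congr {n : ℕ} {y y' : (Fin n → ℕ) → ℝ} {p : MvPolynomial (Fin n) ℝ} {N : ℕ}
    (hp : p.totalDegree ≤ N) (h : ∀ γ, degSum γ ≤ N → y γ = y' γ) : riesz y p = riesz y' p := by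
  refine Finset.sum_congr rfl fun m hm => ?_
  have : degSum (m : Fin n → ℕ) ≤ N := by
    rw [degSum_coe]; exact (degree_le_of_mem hm).trans hp
  rw [h _ this]

/-- exponent `(a,k)` -/
def ee {n : ℕ} (a : Fin n →₀ ℕ) (k : ℕ) : Fin (n + 1) →₀ ℕ :=
  Finsupp.mapDomain Fin.castSucc a + Finsupp.single (Fin.last n) k

lemma ee_coe {n : ℕ} (a : Fin n →₀ ℕ) (k : ℕ) : ⇑(ee a k) = idxZ (a : Fin n → ℕ) k := by
  funext i
  refine Fin.lastCases ?_ (fun i => ?_) i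
  · have : Finsupp.mapDomain Fin.castSucc a (Fin.last n) = 0 := by
      apply Finsupp.mapDomain_notin_range
      rintro ⟨y, hy⟩
      exact (Fin.castSucc_lt_last y).ne hy
    simp [ee, idxZ, this]
  · have : Finsupp.mapDomain Fin.castSucc a (Fin.castSucc i) = a i :=
      Finsupp.mapDomain_apply (Fin.castSucc_injective n) a i
    have h2 : (Fin.last n) ≠ Fin.castSucc i := (Fin.castSucc_lt_last i).ne'
    simp [ee, idxZ, this, h2.symm]

lemma ee_surj {n : ℕ} (γ : Fin (n+1) →₀ ℕ) : ∃ a k, γ = ee a k := by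
  refine ⟨Finsupp.equivFunOnFinite.symm fun i => γ i.castSucc, γ (Fin.last n), ?_⟩
  apply DFunLike.coe_injective
  rw [ee_coe]
  funext i
  refine Fin.lastCases ?_ (fun i => ?_) i
  · simp [idxZ]
  · simp [idxZ]

lemma ee_degree {n : ℕ} (a : Fin n →₀ ℕ) (k : ℕ) : (ee a k).degree = a.degree + k := by
  simp [ee, Finsupp.degree_mapDomain]

lemma ee_add {n : ℕ} (a a' : Fin n →₀ ℕ) (k k' : ℕ) : ee a k + ee a' k' = ee (a + a') (k + k') := by
  simp only [ee, Finsupp.mapDomain_add, Finsupp.single_add]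
  abel

lemma liftP_mon {n : ℕ} (a : Fin n →₀ ℕ) (c : ℝ) : liftP (monomial a c) = monomial (ee a 0) c := by
  simp [liftP, ee, rename_monomial]

lemma zP_eq (n : ℕ) : zP n = monomial (ee 0 1) 1 := by
  simp [zP, ee, X]

lemma monom_eq {n : ℕ} (a : Fin n →₀ ℕ) : monom (a : Fin n → ℕ) = pev (monomial a 1) := by
  funext x
  simp [monom, pev, eval_monomial, Finsupp.prod_fintype]

lemma monom_cont {n : ℕ} (a : Fin n → ℕ) : Continuous (monom a) := by
  unfold monom; fun_prop

section phi
variable {n : ℕ} {φ : Measure (EuclideanSpace ℝ (Fin n))} [IsFiniteMeasure φ]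
    {K : Set (EuclideanSpace ℝ (Fin n))} {v : (Fin n → ℕ) → ℝ}

lemma RL_phi (hK : IsCompact K) (hφ : ∀ᵐ x ∂φ, x ∈ K) (hv : ∀ α, v α = ∫ x, monom α x ∂φ)
    (p : MvPolynomial (Fin n) ℝ) : RL v p = ∫ x, pev p x ∂φ := by
  induction p using MvPolynomial.monomial_add_induction_on with
  | C a =>
    have h : (C a : MvPolynomial (Fin n) ℝ) = monomial 0 a := rfl
    rw [h, RL_mon, hv]
    simp [monom, pev]
    ring
  | monomial_add m c p hm hc hp =>
    have h1 : ∀ x, pev (monomial m c + p) x = c * monom m x + pev p x := by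
      intro x
      rw [monom_eq]
      simp [pev, eval_monomial]
    simp_rw [h1]
    rw [map_add, RL_mon, hp, hv, integral_add, integral_const_mul]
    · exact (integrable_cont hK hφ (monom_cont _)).const_mul c
    · exact integrable_cont hK hφ (pev_continuous p)

lemma RL_lift {d : ℕ} {u : (Fin (n+1) → ℕ) → ℝ}
    (hu : ∀ α : Fin n → ℕ, degSum α ≤ 2 * d → u (idxZ α 0) = v α)
    (p : MvPolynomial (Fin n) ℝ) (hp : p.totalDegree ≤ 2 * d) : RL u (liftP p) = RL v p := by
  have h : liftP p = ∑ m ∈ p.support, monomial (ee m 0) (p.coeff m) := by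
    conv_lhs => rw [p.as_sum]
    rw [liftP, map_sum]
    exact Finset.sum_congr rfl fun m _ => liftP_mon m _
  rw [h, map_sum]
  conv_rhs => rw [p.as_sum, map_sum]
  refine Finset.sum_congr rfl fun m hm => ?_
  rw [RL_mon, RL_mon, ee_coe, hu]
  rw [degSum_coe]
  exact (degree_le_of_mem hm).trans hp

lemma v_le (hK : IsCompact K) (hφ : ∀ᵐ x ∂φ, x ∈ K) (hbox : ∀ x ∈ K, ∀ i, |x i| ≤ 1)
    (hv : ∀ α, v α = ∫ x, monom α x ∂φ) (α : Fin n → ℕ) : v α ≤ φ.real Set.univ := by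
  rw [hv]
  have : ∫ x, (1:ℝ) ∂φ = φ.real Set.univ := by simp
  rw [← this]
  refine integral_mono_ae (integrable_cont hK hφ (monom_cont _)) (integrable_const _) ?_
  filter_upwards [hφ] with x hx
  calc monom α x ≤ |monom α x| := le_abs_self _
    _ = ∏ i, |x i| ^ α i := by simp [monom, Finset.abs_prod, abs_pow]
    _ ≤ 1 := Finset.prod_le_one (fun i _ => by positivity)
        fun i _ => pow_le_one₀ (abs_nonneg _) (hbox x hx i)

lemma even_bound (hvle : ∀ α, v α ≤ φ.real Set.univ) {θ : MvPolynomial (Fin (n+1)) ℝ} {τ : ℝ} {ℓ d : ℕ}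
    {u : (Fin (n+1) → ℕ) → ℝ} (hu : FeasSDP2 θ τ ℓ v d u) (k : ℕ) :
    ∀ a : Fin n →₀ ℕ, a.degree + k ≤ d →
      u (ee a k + ee a k : Fin (n+1) →₀ ℕ) ≤ (max τ 1) ^ k * φ.real Set.univ := by
  obtain ⟨-, h2, h3, -, h5, -⟩ := hu
  induction k with
  | zero =>
    intro a ha
    rw [ee_add, ee_coe, add_zero, h2, pow_zero, one_mul]
    · exact hvle _
    · rw [degSum_coe, map_add]; omega
  | succ k ih =>
    intro a ha
    have hi := ih a (by omega)
    have hd : (monomial (ee a k) (1:ℝ)).totalDegree ≤ d - 1 :=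
      (totalDegree_mono _ _).trans (by rw [ee_degree]; omega)
    have hp := h3 (monomial (ee a k) 1) (hd.trans (by omega))
    have hq := h5 (monomial (ee a k) 1) hd
    rw [riesz_eq] at hp hq
    have e1 : (monomial (ee a k) (1:ℝ))^2 = monomial (ee a k + ee a k) 1 := by
      rw [sq, monomial_mul, one_mul]
    have e2 : zP n ^ 2 * monomial (ee a k + ee a k) (1:ℝ) = monomial (ee a (k+1) + ee a (k+1)) 1 := by
      rw [zP_eq, sq, monomial_mul, monomial_mul]
      simp only [ee_add]
      have hk : 1 + 1 + (k + k) = k + 1 + (k + 1) := by ring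
      rw [hk]
      simp
    rw [e1, RL_mon, one_mul] at hp
    rw [e1, sub_mul, e2, C_mul_monomial, map_sub, RL_mon, RL_mon, one_mul, mul_one] at hq
    have h6 : τ * u (ee a k + ee a k : Fin (n+1) →₀ ℕ) ≤ max τ 1 * u (ee a k + ee a k : Fin (n+1) →₀ ℕ) := by
      gcongr; exact le_max_left _ _
    have h7 : max τ 1 * u (ee a k + ee a k : Fin (n+1) →₀ ℕ) ≤ max τ 1 * (max τ 1 ^ k * φ.real Set.univ) := by
      gcongr
    rw [pow_succ']
    linarith

lemma all_bound (hvle : ∀ α, v α ≤ φ.real Set.univ) {θ : MvPolynomial (Fin (n+1)) ℝ} {τ : ℝ} {ℓ d : ℕ}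
    {u : (Fin (n+1) → ℕ) → ℝ} (hu : FeasSDP2 θ τ ℓ v d u) (γ : Fin (n+1) → ℕ) :
    |u γ| ≤ (max τ 1) ^ d * φ.real Set.univ := by
  have hT : 1 ≤ max τ 1 := le_max_right _ _
  have hev : ∀ β : Fin (n+1) →₀ ℕ, β.degree ≤ d → u (β + β : Fin (n+1) →₀ ℕ) ≤ (max τ 1) ^ d * φ.real Set.univ := by
    intro β hβ
    obtain ⟨a, k, rfl⟩ := ee_surj β
    rw [ee_degree] at hβ
    refine (even_bound hvle hu k a hβ).trans ?_
    have hkd : k ≤ d := by omega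
    gcongr
  by_cases hγ : 2 * d < degSum γ
  · rw [hu.1 γ hγ, abs_zero]; positivity
  obtain ⟨c, rfl⟩ : ∃ c : Fin (n+1) →₀ ℕ, γ = c := ⟨Finsupp.equivFunOnFinite.symm γ, by simp⟩
  rw [degSum_coe, not_lt] at hγ
  obtain ⟨β, β', hβ, hβ', rfl⟩ : ∃ β β' : Fin (n+1) →₀ ℕ, β.degree ≤ d ∧ β'.degree ≤ d ∧ c = β + β' := by
    rcases le_total c.degree d with h | h
    · exact ⟨c, 0, h, by simp, by simp⟩
    · obtain ⟨β, hβ, hd⟩ := Finsupp.exists_le_degree_eq c d h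
      refine ⟨β, c - β, hd.le, ?_, (add_tsub_cancel_of_le hβ).symm⟩
      have : (β + (c - β)).degree = c.degree := by rw [add_tsub_cancel_of_le hβ]
      rw [map_add] at this
      omega
  have h3 := hu.2.2.1
  have key : ∀ t : ℝ, 0 ≤ u (β + β : Fin (n+1) →₀ ℕ) + 2 * t * u (β + β' : Fin (n+1) →₀ ℕ)
      + t ^ 2 * u (β' + β' : Fin (n+1) →₀ ℕ) := by
    intro t
    have := h3 (monomial β 1 + monomial β' t) ((totalDegree_add _ _).trans
      (max_le ((totalDegree_mono _ _).trans hβ) ((totalDegree_mono _ _).trans hβ')))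
    rw [riesz_eq] at this
    have e : (monomial β (1:ℝ) + monomial β' t)^2 = monomial (β + β) 1 + monomial (β + β') (2 * t)
        + monomial (β' + β') (t^2) := by
      rw [add_sq, sq, sq, monomial_mul, monomial_mul, mul_assoc, monomial_mul, one_mul, one_mul, ← sq]
      congr 2
      rw [two_mul (monomial _ _), ← map_add, two_mul]
    rw [e, map_add, map_add, RL_mon, RL_mon, RL_mon, one_mul] at this
    exact this
  have k1 := key 1
  have k2 := key (-1)
  have b1 := hev β hβ
  have b2 := hev β' hβ'
  rw [abs_le]
  constructor <;> linarith

end phi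

lemma riesz_cont {n : ℕ} (p : MvPolynomial (Fin n) ℝ) : Continuous fun y => riesz y p := by
  unfold riesz
  fun_prop

lemma feas_closed {n : ℕ} (θ : MvPolynomial (Fin (n + 1)) ℝ) (τ : ℝ) (ℓ : ℕ)
    (v : (Fin n → ℕ) → ℝ) (d : ℕ) : IsClosed {u | FeasSDP2 θ τ ℓ v d u} := by
  unfold FeasSDP2 locZero locPSD
  simp only [Set.setOf_and, Set.setOf_forall]
  refine IsClosed.inter ?_ (IsClosed.inter ?_ (IsClosed.inter ?_ (IsClosed.inter ?_ (IsClosed.inter ?_ ?_))))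
  · exact isClosed_iInter fun γ => isClosed_iInter fun _ => isClosed_eq (continuous_apply γ) continuous_const
  · exact isClosed_iInter fun γ => isClosed_iInter fun _ => isClosed_eq (continuous_apply _) continuous_const
  · exact isClosed_iInter fun γ => isClosed_iInter fun _ => isClosed_le continuous_const (riesz_cont _)
  · exact isClosed_iInter fun γ => isClosed_iInter fun _ => isClosed_iInter fun _ => isClosed_iInter fun _ =>
      isClosed_eq (riesz_cont _) continuous_const
  · exact isClosed_iInter fun γ => isClosed_iInter fun _ => isClosed_le continuous_const (riesz_cont _)
  · exact isClosed_iInter fun γ => isClosed_iInter fun _ => isClosed_le continuous_const (riesz_cont _)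

lemma exists_opt {n : ℕ} (θ : MvPolynomial (Fin (n + 1)) ℝ) (τ : ℝ) (ℓ : ℕ)
    (v : (Fin n → ℕ) → ℝ) (d : ℕ) (M : ℝ) (hM : ∀ u, FeasSDP2 θ τ ℓ v d u → ∀ γ, |u γ| ≤ M)
    (hf : ∃ u, FeasSDP2 θ τ ℓ v d u) :
    (∃ u, IsMaxSDP2 θ τ ℓ v d u) ∧ (∃ w, IsMinSDP2 θ τ ℓ v d w) := by
  have hc : IsCompact {u | FeasSDP2 θ τ ℓ v d u} := by
    refine (isCompact_univ_pi (s := fun _ : Fin (n+1) → ℕ => Set.Icc (-M) M)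
      fun _ => isCompact_Icc).of_isClosed_subset (feas_closed θ τ ℓ v d) ?_
    intro u hu γ _
    exact abs_le.1 (hM u hu γ)
  have hcont : ContinuousOn (fun u : (Fin (n+1) → ℕ) → ℝ => u (idxZ (fun _ => 0) 1))
    {u | FeasSDP2 θ τ ℓ v d u} := (continuous_apply _).continuousOn
  obtain ⟨u, hu, hmax⟩ := hc.exists_isMaxOn hf hcont
  obtain ⟨w, hw, hmin⟩ := hc.exists_isMinOn hf hcont
  exact ⟨⟨u, hu, fun u' hu' => hmax hu'⟩, ⟨w, hw, fun u' hu' => hmin hu'⟩⟩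

lemma totalDegree_pderiv {n : ℕ} (i : Fin n) (p : MvPolynomial (Fin n) ℝ) :
    (pderiv i p).totalDegree ≤ p.totalDegree - 1 := by
  conv_lhs => rw [p.as_sum]
  rw [map_sum]
  refine totalDegree_finsetSum_le fun m hm => ?_
  rw [pderiv_monomial]
  by_cases h : m i = 0
  · simp [h]
  · refine (totalDegree_mono _ _).trans ?_
    have h1 := degree_le_of_mem hm
    have h2 : m - Finsupp.single i 1 + Finsupp.single i 1 = m := by
      apply tsub_add_cancel_of_le
      simp; omega
    have h3 := congrArg Finsupp.degree h2
    rw [map_add, Finsupp.degree_single] at h3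
    omega

lemma totalDegree_liftP {n : ℕ} (p : MvPolynomial (Fin n) ℝ) : (liftP p).totalDegree ≤ p.totalDegree :=
  totalDegree_rename_le _ _

lemma totalDegree_zP (n : ℕ) : (zP n).totalDegree = 1 := totalDegree_X _

lemma totalDegree_theta {n : ℕ} (p : MvPolynomial (Fin n) ℝ) :
    (thetaP p).totalDegree ≤ max 2 (2 * (p.totalDegree - 1)) := by
  unfold thetaP
  refine (totalDegree_sub _ _).trans (max_le_max ?_ ?_)
  · refine (totalDegree_pow _ _).trans ?_
    rw [totalDegree_zP]
  · refine totalDegree_finsetSum_le fun i _ => ?_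
    refine (totalDegree_pow _ _).trans ?_
    have := (totalDegree_liftP _).trans (totalDegree_pderiv i p)
    omega

/-- truncation -/
def trunc {n : ℕ} (d : ℕ) (u : (Fin n → ℕ) → ℝ) : (Fin n → ℕ) → ℝ :=
  fun γ => if degSum γ ≤ 2 * d then u γ else 0

lemma riesz_trunc {n : ℕ} {d : ℕ} (u : (Fin n → ℕ) → ℝ) {p : MvPolynomial (Fin n) ℝ}
    (hp : p.totalDegree ≤ 2 * d) : riesz (trunc d u) p = riesz u p :=
  riesz_congr hp fun γ hγ => by simp [trunc, hγ]

lemma degSum_idxZ {n : ℕ} (α : Fin n → ℕ) (k : ℕ) : degSum (idxZ α k) = degSum α + k := by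
  simp [degSum, idxZ, Fin.sum_univ_castSucc]

lemma feas_trunc {n : ℕ} {p : MvPolynomial (Fin n) ℝ} {τ : ℝ} {v : (Fin n → ℕ) → ℝ}
    {d₁ d₂ : ℕ} {u : (Fin (n+1) → ℕ) → ℝ} (h2 : 2 ≤ p.totalDegree) (hd : d₁ ≤ d₂) (hd1 : 1 ≤ d₁)
    (hd1' : p.totalDegree - 1 ≤ d₁)
    (hu : FeasSDP2 (thetaP p) τ (p.totalDegree - 1) v d₂ u) :
    FeasSDP2 (thetaP p) τ (p.totalDegree - 1) v d₁ (trunc d₁ u) := by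
  obtain ⟨a1, a2, a3, a4, a5, a6⟩ := hu
  refine ⟨fun γ hγ => by simp [trunc, hγ], fun α hα => ?_, fun q hq => ?_, fun q r hq hr => ?_,
    fun q hq => ?_, fun q hq => ?_⟩
  · rw [trunc, if_pos (by rw [degSum_idxZ]; omega)]
    exact a2 α (by omega)
  · rw [riesz_trunc]
    · exact a3 q (by omega)
    · refine (totalDegree_pow _ _).trans (by omega)
  · rw [riesz_trunc]
    · exact a4 q r (by omega) (by omega)
    · refine (totalDegree_mul _ _).trans ?_
      have := totalDegree_mul q r
      have := totalDegree_theta p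
      have : max 2 (2 * (p.totalDegree - 1)) = 2 * (p.totalDegree - 1) := max_eq_right (by omega)
      omega
  · rw [riesz_trunc]
    · exact a5 q (by omega)
    · refine (totalDegree_mul _ _).trans ?_
      have := totalDegree_pow q 2
      have h3 : (C τ - zP n ^ 2).totalDegree ≤ 2 := by
        refine (totalDegree_sub _ _).trans (max_le (by simp) ((totalDegree_pow _ _).trans ?_))
        rw [totalDegree_zP]
      omega
  · rw [riesz_trunc]
    · exact a6 q (by omega)
    · refine (totalDegree_mul _ _).trans ?_
      have := totalDegree_pow q 2
      rw [totalDegree_zP]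
      omega

lemma v0_of_linear {n : ℕ} {p : MvPolynomial (Fin n) ℝ} {τ : ℝ} {v : (Fin n → ℕ) → ℝ}
    {d : ℕ} {u : (Fin (n+1) → ℕ) → ℝ} (h2 : p.totalDegree ≤ 1)
    (hu : FeasSDP2 (thetaP p) τ (p.totalDegree - 1) v d u) :
    (∀ x, gradSq p x = 0) ∨ v (fun _ => 0) = 0 := by
  have hC : ∀ i, ∃ c, pderiv i p = C c := fun i =>
    ⟨_, totalDegree_eq_zero_iff_eq_C.1 (by have := totalDegree_pderiv i p; omega)⟩
  choose c hc using hC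
  have hg : ∀ x, gradSq p x = ∑ i, c i ^ 2 := by
    intro x; simp [gradSq, hc, pev]
  have hth : thetaP p = zP n ^ 2 - C (∑ i, c i ^ 2) := by
    simp [thetaP, hc, liftP]
  set s := ∑ i, c i ^ 2
  by_cases hs : s = 0
  · left; intro x; rw [hg, hs]
  right
  obtain ⟨a1, a2, -, a4, -, -⟩ := hu
  have hz : ∀ k, zP n ^ k = monomial (ee 0 k) 1 := by
    intro k
    simp [zP, ee, X_pow_eq_monomial]
  have step : ∀ k ≤ d, u (idxZ (fun _ => 0) (2 * k + 2)) = s * u (idxZ (fun _ => 0) (2 * k)) := by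
    intro k hk
    have hdeg : (zP n ^ k).totalDegree ≤ d - (p.totalDegree - 1) := by
      refine (totalDegree_pow _ _).trans ?_
      rw [totalDegree_zP]; omega
    have := a4 (zP n ^ k) (zP n ^ k) hdeg hdeg
    have e : thetaP p * (zP n ^ k * zP n ^ k) = monomial (ee 0 (2 * k + 2)) 1 - monomial (ee 0 (2 * k)) s := by
      rw [hth, ← hz, sub_mul, ← pow_add, ← pow_add, hz (k + k), C_mul_monomial, mul_one]
      congr 2
      · ring
      · rw [two_mul]
    rw [riesz_eq, e, map_sub, RL_mon, RL_mon, ee_coe, ee_coe, one_mul] at this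
    exact sub_eq_zero.1 this
  have hall : ∀ k ≤ d + 1, u (idxZ (fun _ => 0) (2 * k)) = s ^ k * u (idxZ (fun _ => 0) 0) := by
    intro k
    induction k with
    | zero => intro _; simp
    | succ k ih =>
      intro hk
      rw [mul_add, mul_one, step k (by omega), ih (by omega)]; ring
  have h1 := hall (d+1) le_rfl
  rw [a1 _ (by rw [degSum_idxZ]; omega), a2 _ (by simp [degSum])] at h1
  exact (mul_eq_zero.1 h1.symm).resolve_left (pow_ne_zero _ hs)

lemma cs {n : ℕ} (L : MvPolynomial (Fin n) ℝ →ₗ[ℝ] ℝ) (p q : MvPolynomial (Fin n) ℝ)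
    (h : ∀ t : ℝ, 0 ≤ L ((C t * p + q) ^ 2)) : L (p * q) ^ 2 ≤ L (p ^ 2) * L (q ^ 2) := by
  have h2 : ∀ t : ℝ, 0 ≤ L (p ^ 2) * (t * t) + (2 * L (p * q)) * t + L (q ^ 2) := by
    intro t
    have e : (C t * p + q) ^ 2 = (t * t) • p ^ 2 + (2 * t) • (p * q) + q ^ 2 := by
      simp only [smul_eq_C_mul, map_mul]
      have : (C (2:ℝ) : MvPolynomial (Fin n) ℝ) = 2 := rfl
      rw [this]; ring
    have := h t
    rw [e, map_add, map_add, map_smul, map_smul, smul_eq_mul, smul_eq_mul] at this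
    linarith
  have := discrim_le_zero h2
  unfold discrim at this
  linarith

lemma key_ineq {n : ℕ} (L : MvPolynomial (Fin n) ℝ →ₗ[ℝ] ℝ) (z G s a : MvPolynomial (Fin n) ℝ)
    (δ : ℝ) (hδ : 0 < δ) (Q P R : MvPolynomial (Fin n) ℝ) (hQ : Q = s ^ 2 + C δ) (hP : P = z - Q)
    (hR : R = G - Q ^ 2)
    (h1 : ∀ t : ℝ, 0 ≤ L ((C t * P + R) ^ 2)) (h2 : ∀ t : ℝ, 0 ≤ L ((C t * P + a) ^ 2))
    (h3 : 0 ≤ L (z * P ^ 2)) (h4 : 0 ≤ L ((s * P) ^ 2)) (h5 : L ((z ^ 2 - G) * P) = 0)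
    (h6 : 0 ≤ L (P ^ 2)) (h7 : 0 ≤ L (R ^ 2)) (h8 : 0 ≤ L (a ^ 2)) :
    δ ^ 2 * L (P * a) ^ 2 ≤ L (R ^ 2) * L (a ^ 2) := by
  have c1 := cs L P R h1
  have c2 := cs L P a h2
  have e : P * R = z * P ^ 2 + (s * P) ^ 2 + δ • P ^ 2 - (z ^ 2 - G) * P := by
    rw [smul_eq_C_mul, hR]
    have : z = P + Q := by rw [hP]; ring
    rw [this, hQ]; ring
  have e2 : L (P * R) = L (z * P ^ 2) + L ((s * P) ^ 2) + δ * L (P ^ 2) := by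
    rw [e, map_sub, map_add, map_add, map_smul, h5, smul_eq_mul, sub_zero]
  have c3 : δ * L (P ^ 2) ≤ L (P * R) := by rw [e2]; linarith
  have c4 : δ ^ 2 * L (P ^ 2) ≤ L (R ^ 2) := by
    rcases h6.eq_or_lt with h | h
    · rw [← h]; simpa using h7
    · have : (δ * L (P ^ 2)) ^ 2 ≤ L (P ^ 2) * L (R ^ 2) :=
        (pow_le_pow_left₀ (by positivity) c3 2).trans c1
      have h' : L (P ^ 2) * (δ ^ 2 * L (P ^ 2)) ≤ L (P ^ 2) * L (R ^ 2) := by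
        calc _ = (δ * L (P ^ 2)) ^ 2 := by ring
          _ ≤ _ := this
      exact le_of_mul_le_mul_left h' h
  calc δ ^ 2 * L (P * a) ^ 2 ≤ δ ^ 2 * (L (P ^ 2) * L (a ^ 2)) := by gcongr
    _ = (δ ^ 2 * L (P ^ 2)) * L (a ^ 2) := by ring
    _ ≤ _ := by gcongr

lemma pev_add' {n : ℕ} (p q : MvPolynomial (Fin n) ℝ) (x) : pev (p + q) x = pev p x + pev q x := by
  simp [pev]

/-- `∑ (∂ᵢ p)²` -/
def GP {n : ℕ} (p : MvPolynomial (Fin n) ℝ) : MvPolynomial (Fin n) ℝ := ∑ i, (pderiv i p) ^ 2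

lemma pev_GP {n : ℕ} (p : MvPolynomial (Fin n) ℝ) (x) : pev (GP p) x = gradSq p x := by
  simp [pev, GP, gradSq]

lemma theta_eq {n : ℕ} (p : MvPolynomial (Fin n) ℝ) : thetaP p = zP n ^ 2 - liftP (GP p) := by
  simp [thetaP, GP, liftP]

lemma approx {n : ℕ} {K : Set (EuclideanSpace ℝ (Fin n))} (hK : IsCompact K)
    (p : MvPolynomial (Fin n) ℝ) {δ : ℝ} (hδ : 0 < δ) (hb : ∀ x ∈ K, δ ≤ gradNorm p x)
    {η : ℝ} (hη : 0 < η) :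
    ∃ s : MvPolynomial (Fin n) ℝ, ∀ x ∈ K, |pev (s ^ 2 + C δ) x - gradNorm p x| ≤ η ∧
      |gradSq p x - pev (s ^ 2 + C δ) x ^ 2| ≤ η := by
  obtain ⟨M, hM⟩ := hK.exists_bound_of_continuousOn (gradNorm_continuous p).continuousOn
  set M' := max M 1 with hM'
  have hM1 : 1 ≤ M' := le_max_right _ _
  let h : EuclideanSpace ℝ (Fin n) → ℝ := fun x => Real.sqrt (gradNorm p x - δ)
  have hh : Continuous h := Real.continuous_sqrt.comp ((gradNorm_continuous p).sub continuous_const)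
  set ε := min 1 η / (9 * M' ^ 2) with hε
  have hm : 0 < min 1 η := lt_min one_pos hη
  have hε0 : 0 < ε := by positivity
  have hε1 : ε * (9 * M' ^ 2) = min 1 η := by rw [hε]; field_simp
  obtain ⟨s, hs⟩ := stone hK hh hε0
  refine ⟨s, fun x hx => ?_⟩
  have h1 : pev (s ^ 2 + C δ) x = pev s x ^ 2 + δ := by simp [pev]
  have hr := hb x hx
  have hrM : gradNorm p x ≤ M' := ((le_abs_self _).trans (hM x hx)).trans (le_max_left _ _)
  have hr0 : 0 < gradNorm p x := hδ.trans_le hr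
  have hsq : gradNorm p x ^ 2 = gradSq p x := Real.sq_sqrt (gradSq_nonneg p x)
  have hh2 : h x ^ 2 = gradNorm p x - δ := Real.sq_sqrt (by linarith)
  have hh0 : 0 ≤ h x := Real.sqrt_nonneg _
  have hhM : h x ≤ M' := by nlinarith
  have hsx := hs x hx
  set A := pev s x
  have hε9 : ε ≤ 1 := by
    have : ε * 1 ≤ ε * (9 * M' ^ 2) := by gcongr; nlinarith
    linarith [min_le_left 1 η]
  have e1 : |A ^ 2 - h x ^ 2| ≤ ε * (3 * M') := by
    have : A ^ 2 - h x ^ 2 = (A - h x) * (A + h x) := by ring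
    rw [this, abs_mul]
    have h2 : |A + h x| ≤ 3 * M' := by
      have := abs_lt.1 hsx
      rw [abs_le]; constructor <;> linarith
    gcongr
  have e2 : |A ^ 2 + δ - gradNorm p x| ≤ ε * (3 * M') := by
    have : A ^ 2 + δ - gradNorm p x = A ^ 2 - h x ^ 2 := by rw [hh2]; ring
    rw [this]; exact e1
  have e3 : ε * (3 * M') ≤ min 1 η := by
    rw [← hε1]; refine mul_le_mul_of_nonneg_left ?_ hε0.le; nlinarith
  rw [h1]
  refine ⟨(e2.trans e3).trans (min_le_right _ _), ?_⟩
  have e4 : gradSq p x - (A ^ 2 + δ) ^ 2 = -((A ^ 2 + δ - gradNorm p x) * (A ^ 2 + δ + gradNorm p x)) := by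
    rw [← hsq]; ring
  have e5 : |A ^ 2 + δ + gradNorm p x| ≤ 3 * M' := by
    have := abs_le.1 ((e2.trans e3).trans (min_le_left _ _))
    rw [abs_le]; constructor <;> linarith
  rw [e4, abs_neg, abs_mul]
  calc _ ≤ ε * (3 * M') * (3 * M') := by gcongr
    _ = ε * (9 * M' ^ 2) := by ring
    _ ≤ η := by rw [hε1]; exact min_le_right _ _

lemma conv_main {n : ℕ} {φ : Measure (EuclideanSpace ℝ (Fin n))} [IsFiniteMeasure φ]
    {K : Set (EuclideanSpace ℝ (Fin n))} {v : (Fin n → ℕ) → ℝ}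
    (hK : IsCompact K) (hφ : ∀ᵐ x ∂φ, x ∈ K) (hbox : ∀ x ∈ K, ∀ i, |x i| ≤ 1)
    (hv : ∀ α, v α = ∫ x, monom α x ∂φ) (p : MvPolynomial (Fin n) ℝ) {δ : ℝ} (hδ : 0 < δ)
    (hb : ∀ x ∈ K, δ ≤ gradNorm p x) (τ : ℝ) (ℓ N : ℕ) (U : ℕ → (Fin (n + 1) → ℕ) → ℝ)
    (hU : ∀ d, N ≤ d → FeasSDP2 (thetaP p) τ ℓ v d (U d)) (α : Fin n → ℕ) :
    Tendsto (fun d => U d (idxZ α 1)) atTop (nhds (∫ x, monom α x * gradNorm p x ∂φ)) := by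
  set Φ := φ.real Set.univ with hΦ
  have hΦ0 : 0 ≤ Φ := measureReal_nonneg
  have hmon1 : ∀ x ∈ K, |monom α x| ≤ 1 := by
    intro x hx
    calc _ = ∏ i, |x i| ^ α i := by simp [monom, Finset.abs_prod, abs_pow]
    _ ≤ 1 := Finset.prod_le_one (fun i _ => by positivity)
        fun i _ => pow_le_one₀ (abs_nonneg _) (hbox x hx i)
  have main : ∀ η > 0, ∀ᶠ d in atTop, 
      |U d (idxZ α 1) - ∫ x, monom α x * gradNorm p x ∂φ| ≤ η * (Φ / δ + Φ) := by
    intro η hη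
    obtain ⟨s, hs⟩ := approx hK p hδ hb hη
    obtain ⟨a, rfl⟩ : ∃ a : Fin n →₀ ℕ, α = a := ⟨Finsupp.equivFunOnFinite.symm α, by simp⟩
    set q := s ^ 2 + C δ with hq
    set r := GP p - q ^ 2 with hr
    set am : MvPolynomial (Fin n) ℝ := monomial a 1 with ham
    set P := zP n - liftP q with hP
    filter_upwards [eventually_ge_atTop (N + ℓ + 1 + P.totalDegree + (liftP r).totalDegree
      + (liftP am).totalDegree + (liftP s * P).totalDegree + (r^2).totalDegree + (am^2).totalDegree
      + (am * q).totalDegree)] with d hd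
    obtain ⟨a1, a2, a3, a4, a5, a6⟩ := hU d (by omega)
    have a3' : ∀ p, p.totalDegree ≤ d → 0 ≤ RL (U d) (p ^ 2) := fun p hp => by
      rw [← riesz_eq]; exact a3 p hp
    have hlift : ∀ p : MvPolynomial (Fin n) ℝ, p.totalDegree ≤ 2 * d →
        RL (U d) (liftP p) = ∫ x, pev p x ∂φ := fun p hp => by
      rw [RL_lift a2 p hp, RL_phi hK hφ hv]
    have hdeg : ∀ (t : ℝ) (A B : MvPolynomial (Fin (n+1)) ℝ), A.totalDegree ≤ d → B.totalDegree ≤ d →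
        (C t * A + B).totalDegree ≤ d := by
      intro t A B hA hB
      refine (totalDegree_add _ _).trans (max_le ((totalDegree_mul _ _).trans ?_) hB)
      simpa using hA
    have k := key_ineq (RL (U d)) (zP n) (liftP (GP p)) (liftP s) (liftP am) δ hδ (liftP q) P (liftP r)
      (by simp [hq, liftP]) hP (by simp [hr, liftP])
      (fun t => a3' _ (hdeg t _ _ (by omega) (by omega)))
      (fun t => a3' _ (hdeg t _ _ (by omega) (by omega)))
      (by rw [← riesz_eq]; exact a6 P (by omega))
      (a3' _ (by omega))
      (by
        have := a4 P 1 (by omega) (by simp)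
        rw [riesz_eq, mul_one, theta_eq] at this
        exact this)
      (a3' _ (by omega)) (a3' _ (by omega)) (a3' _ (by omega))
    have r1 : RL (U d) (liftP r ^ 2) = ∫ x, pev (r ^ 2) x ∂φ := by
      rw [← hlift _ (by omega)]; simp [liftP]
    have r2 : RL (U d) (liftP am ^ 2) = ∫ x, pev (am ^ 2) x ∂φ := by
      rw [← hlift _ (by omega)]; simp [liftP]
    have r3 : RL (U d) (P * liftP am) = U d (idxZ a 1) - ∫ x, pev (am * q) x ∂φ := by
      rw [← hlift _ (by omega)]
      have : P * liftP am = monomial (ee a 1) 1 - liftP (am * q) := by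
        have e : zP n * liftP am = monomial (ee a 1) 1 := by
          rw [zP_eq, liftP_mon, monomial_mul, ee_add]; simp
        rw [hP, sub_mul, e]; simp [liftP, mul_comm]
      rw [this, map_sub, RL_mon, ee_coe, one_mul]
    have b1 : ∫ x, pev (r ^ 2) x ∂φ ≤ η ^ 2 * Φ := by
      have : ∫ x, η ^ 2 ∂φ = η ^ 2 * Φ := by simp [hΦ, mul_comm]
      rw [← this]
      refine integral_mono_ae (integrable_cont hK hφ (pev_continuous _)) (integrable_const _) ?_
      filter_upwards [hφ] with x hx
      have h1 : pev (r ^ 2) x = (gradSq p x - pev q x ^ 2) ^ 2 := by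
        rw [← pev_GP]; simp [pev, hr]
      rw [h1]
      exact sq_le_sq' (abs_le.1 (hs x hx).2).1 (abs_le.1 (hs x hx).2).2
    have b2 : ∫ x, pev (am ^ 2) x ∂φ ≤ Φ := by
      have : ∫ x, (1:ℝ) ∂φ = Φ := by simp [hΦ]
      rw [← this]
      refine integral_mono_ae (integrable_cont hK hφ (pev_continuous _)) (integrable_const _) ?_
      filter_upwards [hφ] with x hx
      have h1 : pev (am ^ 2) x = monom a x ^ 2 := by
        rw [monom_eq]; simp only [pev, map_pow, ham]
      rw [h1]
      exact (sq_le_one_iff_abs_le_one _).2 (hmon1 x hx)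
    have b3 : |∫ x, pev (am * q) x ∂φ - ∫ x, monom a x * gradNorm p x ∂φ| ≤ η * Φ := by
      rw [← integral_sub (integrable_cont hK hφ (pev_continuous _))
        (integrable_cont (f := fun x => monom a x * gradNorm p x) hK hφ ((monom_cont _).mul (gradNorm_continuous p)))]
      have := norm_integral_le_of_norm_le_const (μ := φ) (C := η)
        (f := fun x => pev (am * q) x - monom a x * gradNorm p x) (by
          filter_upwards [hφ] with x hx
          have h1 : pev (am * q) x = monom a x * pev q x := by
            rw [monom_eq]; simp only [pev, map_mul, ham]
          rw [h1, ← mul_sub, norm_mul]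
          calc _ ≤ 1 * η := mul_le_mul (hmon1 x hx) (hs x hx).1 (abs_nonneg _) zero_le_one
            _ = η := one_mul _)
      exact this
    rw [r1, r2, r3] at k
    have b4 : δ * |U d (idxZ a 1) - ∫ x, pev (am * q) x ∂φ| ≤ η * Φ := by
      apply abs_le_of_sq_le_sq' _ (by positivity) |>.2
      have hn : 0 ≤ ∫ x, pev (am ^ 2) x ∂φ := r2 ▸ a3' _ (by omega)
      calc _ = δ ^ 2 * (U d (idxZ a 1) - ∫ x, pev (am * q) x ∂φ) ^ 2 := by rw [mul_pow, sq_abs]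
        _ ≤ _ := k
        _ ≤ (η ^ 2 * Φ) * Φ := by gcongr
        _ = _ := by ring
    have b5 : |U d (idxZ a 1) - ∫ x, pev (am * q) x ∂φ| ≤ η * Φ / δ := by
      rw [le_div_iff₀ hδ]; linarith
    calc _ ≤ |U d (idxZ a 1) - ∫ x, pev (am * q) x ∂φ| + 
        |∫ x, pev (am * q) x ∂φ - ∫ x, monom a x * gradNorm p x ∂φ| := abs_sub_le _ _ _
      _ ≤ η * Φ / δ + η * Φ := add_le_add b5 b3
      _ = _ := by ring
  rw [Metric.tendsto_nhds]
  intro ε hε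
  have hpos : 0 < Φ / δ + Φ + 1 := by positivity
  filter_upwards [main (ε / (Φ / δ + Φ + 1)) (by positivity)] with d hd
  rw [Real.dist_eq]
  refine hd.trans_lt ?_
  rw [div_mul_eq_mul_div, div_lt_iff₀ hpos]
  nlinarith

/-- Fix `j`, let `ℓ_j = d_j − 1`, `θ_j(x,z) = z² − ‖∇g_j(x)‖²` and
`τ > sup_{x∈Ω_j} ‖∇g_j(x)‖²`.  If the order-`d` second-step SDPs (with data the moments of
`φ_j`) are feasible for all `d ≥ d²_min = max{1, r₁,…,r_m, ℓ_j}`, then they have optimal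
solutions `u^d` (sup) and `w^d` (inf), `u^d_{α,1} → ∫_{Ω_j} x^α dσ_j` and
`w^d_{α,1} → ∫_{Ω_j} x^α dσ_j` for every `α`, `ρ̄_{j,d} = u^d_{0,1} ↓ σ_j(Ω_j)` and
`ρ̲_{j,d} = w^d_{0,1} ↑ σ_j(Ω_j)` as `d → ∞`. -/
theorem statement6 {n m : ℕ} (g : Fin m → MvPolynomial (Fin n) ℝ) (b : Fin m → ℝ)
    (j : Fin m) (τ : ℝ)
    (hcomp : IsCompact (Om g b))
    (hbox : Om g b ⊆ Box n)
    (hgrad : ∀ k, ∀ x ∈ OmJ g b k, gradNorm (g k) x ≠ 0)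
    (hτ : ∀ x ∈ OmJ g b j, gradSq (g j) x < τ)
    (hfeas : ∀ d : ℕ,
      max 1 (max (Finset.univ.sup fun k => ((g k).totalDegree + 1) / 2)
        ((g j).totalDegree - 1)) ≤ d →
      ∃ u, FeasSDP2 (thetaP (g j)) τ ((g j).totalDegree - 1) (phiMom g b j) d u) :
    (∀ d : ℕ,
      max 1 (max (Finset.univ.sup fun k => ((g k).totalDegree + 1) / 2)
        ((g j).totalDegree - 1)) ≤ d →
      (∃ u, IsMaxSDP2 (thetaP (g j)) τ ((g j).totalDegree - 1) (phiMom g b j) d u) ∧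
      (∃ w, IsMinSDP2 (thetaP (g j)) τ ((g j).totalDegree - 1) (phiMom g b j) d w)) ∧
    ∀ (U W : ℕ → (Fin (n + 1) → ℕ) → ℝ),
      (∀ d : ℕ,
        max 1 (max (Finset.univ.sup fun k => ((g k).totalDegree + 1) / 2)
          ((g j).totalDegree - 1)) ≤ d →
        IsMaxSDP2 (thetaP (g j)) τ ((g j).totalDegree - 1) (phiMom g b j) d (U d) ∧
        IsMinSDP2 (thetaP (g j)) τ ((g j).totalDegree - 1) (phiMom g b j) d (W d)) →
      (∀ α : Fin n → ℕ,
        Tendsto (fun d => U d (idxZ α 1)) atTop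
          (nhds (∫ x in OmJ g b j, monom α x ∂(hsd n))) ∧
        Tendsto (fun d => W d (idxZ α 1)) atTop
          (nhds (∫ x in OmJ g b j, monom α x ∂(hsd n)))) ∧
      (∀ d₁ d₂ : ℕ,
        max 1 (max (Finset.univ.sup fun k => ((g k).totalDegree + 1) / 2)
          ((g j).totalDegree - 1)) ≤ d₁ → d₁ ≤ d₂ →
        U d₂ (idxZ (fun _ => 0) 1) ≤ U d₁ (idxZ (fun _ => 0) 1) ∧
        W d₁ (idxZ (fun _ => 0) 1) ≤ W d₂ (idxZ (fun _ => 0) 1)) ∧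
      Tendsto (fun d => U d (idxZ (fun _ => 0) 1)) atTop
        (nhds ((hsd n) (OmJ g b j)).toReal) ∧
      Tendsto (fun d => W d (idxZ (fun _ => 0) 1)) atTop
        (nhds ((hsd n) (OmJ g b j)).toReal) := by
  have hK : IsCompact (OmJ g b j) := OmJ_compact hcomp
  haveI : IsFiniteMeasure (phiJ g b j) := phi_fin hcomp hgrad
  have hφ : ∀ᵐ x ∂(phiJ g b j), x ∈ OmJ g b j := phi_ae hcomp
  have hb1 : ∀ x ∈ OmJ g b j, ∀ i, |x i| ≤ 1 := fun x hx i => (hbox hx.1 i).le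
  have hv : ∀ α, phiMom g b j α = ∫ x, monom α x ∂(phiJ g b j) := fun _ => rfl
  have hvle := v_le hK hφ hb1 hv
  obtain ⟨δ, hδ, hδb⟩ := exists_delta (j := j) hcomp hgrad
  refine ⟨fun d hd => exists_opt _ _ _ _ _ _ (fun u hu γ => all_bound hvle hu γ) (hfeas d hd), ?_⟩
  intro U W hUW
  have hc : ∀ (V : ℕ → (Fin (n + 1) → ℕ) → ℝ), (∀ d : ℕ,
      max 1 (max (Finset.univ.sup fun k => ((g k).totalDegree + 1) / 2)
        ((g j).totalDegree - 1)) ≤ d →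
      FeasSDP2 (thetaP (g j)) τ ((g j).totalDegree - 1) (phiMom g b j) d (V d)) → ∀ α : Fin n → ℕ,
      Tendsto (fun d => V d (idxZ α 1)) atTop
          (nhds (∫ x in OmJ g b j, monom α x ∂(hsd n))) := by
    intro V hV α
    rw [← phi_integral hcomp hgrad]
    exact conv_main hK hφ hb1 hv (g j) hδ hδb τ _ _ V hV α
  have hcU := hc U fun d hd => (hUW d hd).1.1
  have hcW := hc W fun d hd => (hUW d hd).2.1
  have h0 : ∫ x in OmJ g b j, monom (fun _ => 0) x ∂(hsd n) = ((hsd n) (OmJ g b j)).toReal := by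
    simp [monom, Measure.real]
  refine ⟨fun α => ⟨hcU α, hcW α⟩, ?_, h0 ▸ hcU _, h0 ▸ hcW _⟩
  intro d₁ d₂ hd1 hd12
  have hd2 := hd1.trans hd12
  have hd1a : 1 ≤ d₁ := (le_max_left _ _).trans hd1
  have hd1b : (g j).totalDegree - 1 ≤ d₁ := ((le_max_right _ _).trans (le_max_right _ _)).trans hd1
  rcases le_or_gt (g j).totalDegree 1 with hdeg | hdeg
  · have hΦ : (phiJ g b j).real Set.univ = 0 := by
      rcases v0_of_linear hdeg (hUW d₁ hd1).1.1 with h | h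
      · have hf : ∀ᵐ x ∂(phiJ g b j), False := by
          filter_upwards [hφ] with x hx
          exact hgrad j x hx (by simp [gradNorm, h])
        have : phiJ g b j = 0 := by
          rw [← MeasureTheory.ae_eq_bot]
          exact Filter.eventually_false_iff_eq_bot.1 hf
        simp [this]
      · rw [hv] at h
        simpa [monom] using h
    have hz : ∀ d u, FeasSDP2 (thetaP (g j)) τ ((g j).totalDegree - 1) (phiMom g b j) d u →
        ∀ γ, u γ = 0 := by
      intro d u hu γ
      have := all_bound hvle hu γ
      rw [hΦ, mul_zero] at this
      exact abs_nonpos_iff.1 this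
    rw [hz _ _ (hUW d₁ hd1).1.1, hz _ _ (hUW d₁ hd1).2.1, hz _ _ (hUW d₂ hd2).1.1,
      hz _ _ (hUW d₂ hd2).2.1]
    exact ⟨le_rfl, le_rfl⟩
  · have ht : ∀ u : (Fin (n + 1) → ℕ) → ℝ, trunc d₁ u (idxZ (fun _ => 0) 1) = u (idxZ (fun _ => 0) 1) := by
      intro u
      rw [trunc, if_pos]
      rw [degSum_idxZ]
      simp [degSum]
      omega
    have t1 := (hUW d₁ hd1).1.2 _ (feas_trunc hdeg hd12 hd1a hd1b (hUW d₂ hd2).1.1)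
    have t2 := (hUW d₁ hd1).2.2 _ (feas_trunc hdeg hd12 hd1a hd1b (hUW d₂ hd2).2.1)
    rw [ht] at t1 t2
    exact ⟨t1, t2⟩
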